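/- For an integer i ≥ 0, let C(i) be the complex of R-modules with C(i)_n = R for all n ∈ ℤ, with differential d_n equal to multiplication by (1−σ) for n even, to multiplication by p^{i+1}·N for odd n ≥ 1, and to multiplication by p^i·N for odd n ≤ −1. Then H_n(C(i)) is isomorphic as an abelian group to ℤ/p^{i+1} for every even n ≥ 0, to ℤ/p^i for every even n < 0, and H_n(C(i)) = 0 for every odd n. -/

import Mathlib

/-- The homology in degree `n` of the `ℤ`-indexed complex of `A`-modules whose terms are
all `A` and whose differential with source in degree `n` is multiplication by `e n`:
the kernel of multiplication by `e n` modulo the image of multiplication by `e (n+1)`. -/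
abbrev hml' {A : Type} [CommRing A] (e : ℤ → A) (n : ℤ) :=
  ↥(LinearMap.ker (LinearMap.lsmul A A (e n))) ⧸
    Submodule.comap (LinearMap.ker (LinearMap.lsmul A A (e n))).subtype
      (LinearMap.range (LinearMap.lsmul A A (e (n + 1))))

/-- The chosen generator `σ`, as an element of the group ring `ℤ[C]`. -/
noncomputable def tG (G : Type) [CommGroup G] (σ : G) : MonoidAlgebra ℤ G :=
  MonoidAlgebra.of ℤ G σ

/-- The norm element `N = Σ_{j=0}^{m-1} σ^j` of the group ring. -/
noncomputable def NG (G : Type) [CommGroup G] (σ : G) (m : ℕ) : MonoidAlgebra ℤ G :=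
  ∑ j ∈ Finset.range m, tG G σ ^ j

/-- The multiplier of the differential with source in degree `n` of the complex `C(i)`:
`(1 - σ)` for `n` even, `p^{i+1}·N` for odd `n ≥ 1`, and `p^i·N` for odd `n ≤ -1`. -/
noncomputable def eC (G : Type) [CommGroup G] (σ : G) (p r i : ℕ) : ℤ → MonoidAlgebra ℤ G :=
  fun n => if Even n then 1 - tG G σ
    else if 1 ≤ n then (p : MonoidAlgebra ℤ G) ^ (i + 1) * NG G σ (p ^ r)
    else (p : MonoidAlgebra ℤ G) ^ i * NG G σ (p ^ r)

section GroupRing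

variable {G : Type} [CommGroup G]

theorem coeff_tG_mul (σ : G) (x : MonoidAlgebra ℤ G) (g : G) :
    (tG G σ * x).coeff g = x.coeff (σ⁻¹ * g) := by
  simp [tG]

theorem one_sub_tG_mul_NG {σ : G} {m : ℕ} (hm : σ ^ m = 1) :
    (1 - tG G σ) * NG G σ m = 0 := by
  rw [NG, mul_neg_geom_sum, tG, ← map_pow, hm, map_one, sub_self]

theorem coeff_NG [Fintype G] {σ : G} (hσ : ∀ x : G, x ∈ Subgroup.zpowers σ) (g : G) :
    (NG G σ (Fintype.card G)).coeff g = 1 := by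
  classical
  have hord : orderOf σ = Fintype.card G := by
    rw [orderOf_eq_card_of_forall_mem_zpowers hσ, Nat.card_eq_fintype_card]
  have hmem : g ∈ (Finset.range (Fintype.card G)).image (fun j => σ ^ j) := by
    rw [← Nat.card_eq_fintype_card, IsCyclic.image_range_card hσ]
    exact Finset.mem_univ g
  obtain ⟨k, hk, rfl⟩ := Finset.mem_image.mp hmem
  have hcoeff : (NG G σ (Fintype.card G)).coeff (σ ^ k) =
      ∑ j ∈ Finset.range (Fintype.card G), if σ ^ j = σ ^ k then (1 : ℤ) else 0 := by
    simp [NG, tG, MonoidAlgebra.single_pow, MonoidAlgebra.coeff_sum, Finsupp.single_apply]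
  rw [hcoeff, Finset.sum_eq_single_of_mem k hk, if_pos rfl]
  intro j hj hjk
  refine if_neg fun h => hjk (pow_injOn_Iio_orderOf ?_ ?_ h)
  · simpa [hord] using hj
  · simpa [hord] using hk

/-- The kernel of multiplication by `1 - σ` consists of the integer multiples of the norm. -/
theorem eq_intCast_mul_NG_of_one_sub_tG_mul_eq_zero [Fintype G] {σ : G}
    (hσ : ∀ x : G, x ∈ Subgroup.zpowers σ) {x : MonoidAlgebra ℤ G}
    (hx : (1 - tG G σ) * x = 0) : x = x.coeff 1 • NG G σ (Fintype.card G) := by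
  have hfix : tG G σ * x = x := by
    rw [sub_mul, one_mul, sub_eq_zero] at hx
    exact hx.symm
  have hpow (j : ℕ) : x.coeff (σ ^ j) = x.coeff 1 := by
    induction j with
    | zero => rw [pow_zero]
    | succ j ih =>
      rw [← ih]
      conv_lhs => rw [← hfix]
      rw [coeff_tG_mul, pow_succ', inv_mul_cancel_left]
  ext g
  obtain ⟨j, rfl⟩ := (mem_powers_iff_mem_zpowers (x := σ)).mpr (hσ g)
  rw [MonoidAlgebra.coeff_smul_apply, coeff_NG hσ, hpow, smul_eq_mul, mul_one]

/-- Modulo `1 - σ`, every element of the group ring is congruent to an integer. -/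
theorem exists_eq_intCast_add_one_sub_tG_mul [Finite G] {σ : G}
    (hσ : ∀ x : G, x ∈ Subgroup.zpowers σ) (x : MonoidAlgebra ℤ G) :
    ∃ (k : ℤ) (y : MonoidAlgebra ℤ G), x = k + (1 - tG G σ) * y := by
  induction x using MonoidAlgebra.induction_on with
  | of g =>
    obtain ⟨j, rfl⟩ := (mem_powers_iff_mem_zpowers (x := σ)).mpr (hσ g)
    refine ⟨1, -∑ l ∈ Finset.range j, tG G σ ^ l, ?_⟩
    rw [mul_neg, mul_neg_geom_sum]
    simp [tG]
  | add x y hx hy =>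
    obtain ⟨k, u, rfl⟩ := hx
    obtain ⟨l, v, rfl⟩ := hy
    exact ⟨k + l, u + v, by push_cast; ring⟩
  | smul c x hx =>
    obtain ⟨k, u, rfl⟩ := hx
    exact ⟨c * k, c * u, by rw [zsmul_eq_mul]; push_cast; ring⟩

theorem intCast_mul_NG_eq_iff [Fintype G] {σ : G} (hσ : ∀ x : G, x ∈ Subgroup.zpowers σ)
    {a b : ℤ} :
    (a : MonoidAlgebra ℤ G) * NG G σ (Fintype.card G) = b * NG G σ (Fintype.card G) ↔ a = b := by
  refine ⟨fun h => ?_, fun h => by rw [h]⟩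
  have := congrArg (fun x : MonoidAlgebra ℤ G => x.coeff 1) h
  simpa [← zsmul_eq_mul, coeff_NG hσ] using this

theorem exists_NG_mul_eq_intCast_mul [Fintype G] {σ : G}
    (hσ : ∀ x : G, x ∈ Subgroup.zpowers σ) (x : MonoidAlgebra ℤ G) :
    ∃ (k : ℤ) (y : MonoidAlgebra ℤ G), x = k + (1 - tG G σ) * y ∧
      NG G σ (Fintype.card G) * x = k * NG G σ (Fintype.card G) := by
  obtain ⟨k, y, rfl⟩ := exists_eq_intCast_add_one_sub_tG_mul hσ x
  refine ⟨k, y, rfl, ?_⟩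
  linear_combination y * one_sub_tG_mul_NG (G := G) (pow_card_eq_one (x := σ))

/-- Homology at a spot with outgoing differential `1 - σ` and incoming differential `q N`. -/
theorem nonempty_hml'_addEquiv_zmod [Fintype G] {σ : G}
    (hσ : ∀ x : G, x ∈ Subgroup.zpowers σ) (e : ℤ → MonoidAlgebra ℤ G) (n : ℤ) (q : ℕ)
    (hout : e n = 1 - tG G σ) (hin : e (n + 1) = q * NG G σ (Fintype.card G)) :
    Nonempty (hml' e n ≃+ ZMod q) := by
  have hN : NG G σ (Fintype.card G) ∈
      LinearMap.ker (LinearMap.lsmul (MonoidAlgebra ℤ G) (MonoidAlgebra ℤ G) (e n)) := by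
    rw [LinearMap.mem_ker, LinearMap.lsmul_apply, smul_eq_mul, hout,
      one_sub_tG_mul_NG pow_card_eq_one]
  let ψ : ℤ →+ hml' e n := zmultiplesHom _ (Submodule.Quotient.mk ⟨_, hN⟩)
  have hψ (k : ℤ) : ψ k = Submodule.Quotient.mk (k • ⟨_, hN⟩) := rfl
  have hsurj : Function.Surjective ψ := by
    intro z
    obtain ⟨⟨x, hx⟩, rfl⟩ := Submodule.Quotient.mk_surjective _ z
    refine ⟨x.coeff 1, ?_⟩
    rw [hψ]
    congr 1
    refine Subtype.ext ?_
    rw [LinearMap.mem_ker, LinearMap.lsmul_apply, smul_eq_mul, hout] at hx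
    exact (eq_intCast_mul_NG_of_one_sub_tG_mul_eq_zero hσ hx).symm
  have hker : ψ.ker = AddSubgroup.zmultiples (q : ℤ) := by
    ext k
    rw [AddMonoidHom.mem_ker, hψ, Submodule.Quotient.mk_eq_zero, Submodule.mem_comap,
      LinearMap.mem_range, Int.mem_zmultiples_iff]
    change (∃ y, e (n + 1) * y = k • NG G σ (Fintype.card G)) ↔ _
    rw [hin, zsmul_eq_mul]
    constructor
    · rintro ⟨y, hy⟩
      obtain ⟨l, -, -, hl⟩ := exists_NG_mul_eq_intCast_mul hσ y
      refine ⟨l, ((intCast_mul_NG_eq_iff hσ).mp ?_).symm⟩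
      rw [← hy, mul_assoc, hl]
      push_cast
      ring
    · rintro ⟨l, rfl⟩
      exact ⟨l, by push_cast; ring⟩
  exact ⟨(QuotientAddGroup.quotientKerEquivOfSurjective ψ hsurj).symm.trans
    ((QuotientAddGroup.quotientAddEquivOfEq hker).trans
      (Int.quotientZMultiplesNatEquivZMod q))⟩

/-- Homology at a spot with outgoing differential `q N` and incoming differential `1 - σ`. -/
theorem subsingleton_hml' [Fintype G] {σ : G}
    (hσ : ∀ x : G, x ∈ Subgroup.zpowers σ) (e : ℤ → MonoidAlgebra ℤ G) (n : ℤ) {q : ℕ}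
    (hq : q ≠ 0) (hout : e n = q * NG G σ (Fintype.card G)) (hin : e (n + 1) = 1 - tG G σ) :
    Subsingleton (hml' e n) := by
  refine Submodule.Quotient.subsingleton_iff.mpr (eq_top_iff.mpr ?_)
  rintro ⟨x, hx⟩ -
  rw [LinearMap.mem_ker, LinearMap.lsmul_apply, smul_eq_mul, hout] at hx
  obtain ⟨k, y, rfl, hk⟩ := exists_NG_mul_eq_intCast_mul hσ x
  have hzero : (q : ℤ) * k = 0 := (intCast_mul_NG_eq_iff hσ).mp <| by
    rw [Int.cast_zero, zero_mul, ← hx, mul_assoc _ _ (_ + _), hk]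
    push_cast
    ring
  obtain rfl : k = 0 := by simpa [hq] using hzero
  refine ⟨y, ?_⟩
  change e (n + 1) * y = _
  simp only [hin, Int.cast_zero, zero_add, Submodule.subtype_apply]

end GroupRing

/-- Let `C` be cyclic of order `p^r` with generator `σ`, `R = ℤ[C]`, and let `C(i)` be the
complex with `C(i)_n = R` for all `n`, differentials `(1-σ)` from even degrees,
`p^{i+1}·N` from odd degrees `n ≥ 1` and `p^i·N` from odd degrees `n ≤ -1`.  Then
`H_n(C(i)) ≅ ℤ/p^{i+1}` for even `n ≥ 0`, `H_n(C(i)) ≅ ℤ/p^i` for even `n < 0`, and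
`H_n(C(i)) = 0` for odd `n`. -/
theorem stmt12 (p : ℕ) (hp : p.Prime) (r : ℕ) (G : Type) [CommGroup G] [Fintype G]
    (hG : Fintype.card G = p ^ r) (σ : G) (hσ : ∀ x : G, x ∈ Subgroup.zpowers σ)
    (i : ℕ) :
    ∀ n : ℤ,
      (Even n → 0 ≤ n → Nonempty (hml' (eC G σ p r i) n ≃+ ZMod (p ^ (i + 1)))) ∧
      (Even n → n < 0 → Nonempty (hml' (eC G σ p r i) n ≃+ ZMod (p ^ i))) ∧
      (Odd n → Subsingleton (hml' (eC G σ p r i) n)) := by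
  have heven {n : ℤ} (hn : Even n) : eC G σ p r i n = 1 - tG G σ := if_pos hn
  have hpos {n : ℤ} (hn : ¬Even n) (h : 1 ≤ n) :
      eC G σ p r i n = (p ^ (i + 1) : ℕ) * NG G σ (Fintype.card G) := by
    simp [eC, hn, h, hG]
  have hneg {n : ℤ} (hn : ¬Even n) (h : ¬1 ≤ n) :
      eC G σ p r i n = (p ^ i : ℕ) * NG G σ (Fintype.card G) := by
    simp [eC, hn, h, hG]
  intro n
  refine ⟨fun hn h => ?_, fun hn h => ?_, fun hn => ?_⟩
  · exact nonempty_hml'_addEquiv_zmod hσ _ n _ (heven hn)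
      (hpos (Int.not_even_iff_odd.mpr hn.add_one) (by lia))
  · exact nonempty_hml'_addEquiv_zmod hσ _ n _ (heven hn)
      (hneg (Int.not_even_iff_odd.mpr hn.add_one) (by lia))
  · have hn' := Int.not_even_iff_odd.mpr hn
    by_cases h : 1 ≤ n
    · exact subsingleton_hml' hσ _ n (pow_ne_zero _ hp.ne_zero) (hpos hn' h) (heven hn.add_one)
    · exact subsingleton_hml' hσ _ n (pow_ne_zero _ hp.ne_zero) (hneg hn' h) (heven hn.add_one)
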